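/- Let ℓ₀ be the smallest integer ℓ ≥ 1 such that h_{Ā₁…Ā_ℓ D}(0) ≠ 0 for some indices (ℓ₀ = ∞ if none exists), and let ℓ₁ be the smallest integer ℓ ≥ 1 such that ⟨θ, [L_Ā_ℓ, [L_Ā_{ℓ−1}, … [L_Ā₁, L_D] … ]]⟩(0) ≠ 0 for some indices A₁, …, A_ℓ, D ∈ {1,…,n} (ℓ₁ = ∞ if none exists). Then: (i) for every integer r with 1 ≤ r ≤ ℓ₀ and all indices A₁, …, A_r, D ∈ {1,…,n}, ⟨θ, [L_Ā_r, [L_Ā_{r−1}, … [L_Ā₁, L_D] … ]]⟩(0) = −h_{Ā₁…Ā_r D}(0); and (ii) if either of ℓ₀, ℓ₁ is finite, then ℓ₀ = ℓ₁. -/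

import Mathlib

open scoped Topology

noncomputable section

/-- A complex vector field on (an open subset of) `ℝ^m`, given by its components:
it acts on functions by `(Xu)(x) = Du(x)·X(x)`. -/
abbrev VF (m : ℕ) := (Fin m → ℝ) → Fin m → ℂ

/-- A complex 1-form on `ℝ^m`, given by its components in the standard coordinates. -/
abbrev Form (m : ℕ) := (Fin m → ℝ) → Fin m → ℂ

/-- The action `(Xu)(x) = Du(x)·X(x)` of a complex vector field on a function. -/
noncomputable def vapp {m : ℕ} (X : VF m) (u : (Fin m → ℝ) → ℂ) (x : Fin m → ℝ) : ℂ :=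
  ∑ i, X x i * fderiv ℝ u x (Pi.single i 1)

/-- The Lie bracket `[X,Y](x) = DY(x)·X(x) − DX(x)·Y(x)` of complex vector fields. -/
noncomputable def vbrk {m : ℕ} (X Y : VF m) : VF m :=
  fun x j => vapp X (fun y => Y y j) x - vapp Y (fun y => X y j) x

/-- The componentwise complex conjugate `X̄` of a complex vector field. -/
def vconj {m : ℕ} (X : VF m) : VF m := fun x i => (starRingEnd ℂ) (X x i)

/-- The pairing `⟨ω,X⟩(x) = ω(x)(X(x))` of a 1-form with a vector field. -/
noncomputable def fpair {m : ℕ} (ω : Form m) (X : VF m) : (Fin m → ℝ) → ℂ :=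
  fun x => ∑ i, ω x i * X x i

/-- `⟨dω, X∧Y⟩ = X⟨ω,Y⟩ − Y⟨ω,X⟩ − ⟨ω,[X,Y]⟩`. -/
noncomputable def dpair {m : ℕ} (ω : Form m) (X Y : VF m) (x : Fin m → ℝ) : ℂ :=
  vapp X (fpair ω Y) x - vapp Y (fpair ω X) x - fpair ω (vbrk X Y) x

/-- The Lie derivative `ℒ_X ω := X ⌟ dω`, in components: its pairing with a constant
coordinate vector field is `⟨dω, X ∧ e_i⟩`. -/
noncomputable def lieD {m : ℕ} (X : VF m) (ω : Form m) : Form m :=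
  fun x i => dpair ω X (fun _ => Pi.single i 1) x

/-- Iterated Lie derivative `ℒ_{X_k} ⋯ ℒ_{X_1} ω`, for `Xs = [X₁,…,X_k]`. -/
noncomputable def iterLieD {m : ℕ} (Xs : List (VF m)) (ω : Form m) : Form m :=
  Xs.foldl (fun w X => lieD X w) ω

/-- `h_{Ā₁…Ā_k B} := ⟨ℒ_{L_{Ā_k}} ⋯ ℒ_{L_{Ā₁}} θ, L_B⟩` (for `As = [A₁,…,A_k]`). -/
noncomputable def hD {n : ℕ} (L : Fin n → VF (2 * n + 1)) (θ : Form (2 * n + 1))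
    (As : List (Fin n)) (B : Fin n) : (Fin (2 * n + 1) → ℝ) → ℂ :=
  fpair (iterLieD (As.map fun A => vconj (L A)) θ) (L B)

/-- `h_{Ā₁…Ā_k} := ⟨ℒ_{L_{Ā_k}} ⋯ ℒ_{L_{Ā₁}} θ, T⟩`. -/
noncomputable def hT {n : ℕ} (L : Fin n → VF (2 * n + 1)) (T : VF (2 * n + 1))
    (θ : Form (2 * n + 1)) (As : List (Fin n)) : (Fin (2 * n + 1) → ℝ) → ℂ :=
  fpair (iterLieD (As.map fun A => vconj (L A)) θ) T

/-- The frame and dual coframe data of Context 5/6/7/18: `T, L_A, L_Ā` is a smooth pointwise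
basis of `ℂ^{2n+1}` on `Ω`, the span of the `L_Ā` is closed under brackets (integrable CR
structure of hypersurface type), and `θ, θ^A, θ^Ā` is the dual coframe. -/
structure CRFrame (n : ℕ) (Ω : Set (Fin (2 * n + 1) → ℝ)) (T : VF (2 * n + 1))
    (L : Fin n → VF (2 * n + 1)) (θ : Form (2 * n + 1))
    (θup θbar : Fin n → Form (2 * n + 1)) : Prop where
  open_Ω : IsOpen Ω
  mem0 : (0 : Fin (2 * n + 1) → ℝ) ∈ Ω
  smoothT : ContDiffOn ℝ (⊤ : ℕ∞) T Ω
  smoothL : ∀ A, ContDiffOn ℝ (⊤ : ℕ∞) (L A) Ω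
  smoothθ : ContDiffOn ℝ (⊤ : ℕ∞) θ Ω
  smoothθup : ∀ A, ContDiffOn ℝ (⊤ : ℕ∞) (θup A) Ω
  smoothθbar : ∀ A, ContDiffOn ℝ (⊤ : ℕ∞) (θbar A) Ω
  indep : ∀ x ∈ Ω, LinearIndependent ℂ
    (Sum.elim (fun _ : Fin 1 => T x) (Sum.elim (fun A => L A x) (fun A => vconj (L A) x)))
  spans : ∀ x ∈ Ω, Submodule.span ℂ
    (Set.range (Sum.elim (fun _ : Fin 1 => T x)
      (Sum.elim (fun A => L A x) (fun A => vconj (L A) x)))) = ⊤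
  integrable : ∀ A B, ∀ x ∈ Ω, vbrk (vconj (L A)) (vconj (L B)) x ∈
    Submodule.span ℂ (Set.range fun C => vconj (L C) x)
  dual_θ_T : ∀ x ∈ Ω, fpair θ T x = 1
  dual_θ_L : ∀ A, ∀ x ∈ Ω, fpair θ (L A) x = 0
  dual_θ_Lb : ∀ A, ∀ x ∈ Ω, fpair θ (vconj (L A)) x = 0
  dual_θup_T : ∀ A, ∀ x ∈ Ω, fpair (θup A) T x = 0
  dual_θup_L : ∀ A B, ∀ x ∈ Ω, fpair (θup A) (L B) x = if A = B then 1 else 0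
  dual_θup_Lb : ∀ A B, ∀ x ∈ Ω, fpair (θup A) (vconj (L B)) x = 0
  dual_θbar_T : ∀ A, ∀ x ∈ Ω, fpair (θbar A) T x = 0
  dual_θbar_L : ∀ A B, ∀ x ∈ Ω, fpair (θbar A) (L B) x = 0
  dual_θbar_Lb : ∀ A B, ∀ x ∈ Ω, fpair (θbar A) (vconj (L B)) x = if A = B then 1 else 0

/-- The iterated commutator `[L_Ā_r, [L_Ā_{r−1}, … [L_Ā₁, L_D] … ]]` (for `As = [A₁,…,A_r]`). -/
noncomputable def brkIter {n : ℕ} (L : Fin n → VF (2 * n + 1)) (As : List (Fin n))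
    (D : Fin n) : VF (2 * n + 1) :=
  As.foldl (fun V A => vbrk (vconj (L A)) V) (L D)

section helpers

abbrev Sm {m : ℕ} {F : Type} [NormedAddCommGroup F] [NormedSpace ℝ F] (Ω : Set (Fin m → ℝ))
    (f : (Fin m → ℝ) → F) : Prop := ContDiffOn ℝ (⊤ : ℕ∞) f Ω

variable {m : ℕ} {Ω : Set (Fin m → ℝ)}

lemma Sm.dat {F : Type} [NormedAddCommGroup F] [NormedSpace ℝ F]
    (hΩ : IsOpen Ω) {f : (Fin m → ℝ) → F} (hf : Sm Ω f) {x : Fin m → ℝ} (hx : x ∈ Ω) :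
    DifferentiableAt ℝ f x :=
  (hf.contDiffAt (hΩ.mem_nhds hx)).differentiableAt (by simp)

lemma Sm.comp' {X : VF m} (hX : Sm Ω X) (i : Fin m) : Sm Ω (fun y => X y i) :=
  (contDiffOn_pi.1 hX) i

lemma sm_vapp (hΩ : IsOpen Ω) {X : VF m} {u : (Fin m → ℝ) → ℂ} (hX : Sm Ω X) (hu : Sm Ω u) :
    Sm Ω (vapp X u) := by
  unfold vapp
  refine ContDiffOn.sum fun i _ => ?_
  refine (Sm.comp' hX i).mul ?_
  have h := hu.fderiv_of_isOpen (m := ((⊤ : ℕ∞) : WithTop ℕ∞)) hΩ (by simp)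
  exact h.clm_apply contDiffOn_const

lemma sm_fpair {ω : Form m} {X : VF m} (hω : Sm Ω ω) (hX : Sm Ω X) : Sm Ω (fpair ω X) := by
  unfold fpair
  exact ContDiffOn.sum fun i _ => (Sm.comp' hω i).mul (Sm.comp' hX i)

lemma sm_vbrk (hΩ : IsOpen Ω) {X Y : VF m} (hX : Sm Ω X) (hY : Sm Ω Y) : Sm Ω (vbrk X Y) := by
  unfold vbrk
  exact contDiffOn_pi.2 fun j => (sm_vapp hΩ hX (Sm.comp' hY j)).sub (sm_vapp hΩ hY (Sm.comp' hX j))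

lemma sm_lieD (hΩ : IsOpen Ω) {X : VF m} {ω : Form m} (hX : Sm Ω X) (hω : Sm Ω ω) :
    Sm Ω (lieD X ω) := by
  refine contDiffOn_pi.2 fun i => ?_
  unfold lieD dpair
  have hc : Sm Ω (fun _ => Pi.single i 1 : VF m) := contDiffOn_const
  exact ((sm_vapp hΩ hX (sm_fpair hω hc)).sub (sm_vapp hΩ hc (sm_fpair hω hX))).sub
    (sm_fpair hω (sm_vbrk hΩ hX hc))

lemma sm_vconj {X : VF m} (hX : Sm Ω X) : Sm Ω (vconj X) := by
  refine contDiffOn_pi.2 fun i => ?_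
  exact Complex.conjCLE.contDiff.comp_contDiffOn (Sm.comp' hX i)

lemma fderiv_fpair {ω : Form m} {X : VF m} {x : Fin m → ℝ} (hω : DifferentiableAt ℝ ω x)
    (hX : DifferentiableAt ℝ X x) (v : Fin m → ℝ) :
    fderiv ℝ (fpair ω X) x v = ∑ j, (ω x j * fderiv ℝ (fun y => X y j) x v
      + X x j * fderiv ℝ (fun y => ω y j) x v) := by
  have h1 := differentiableAt_pi.1 hω
  have h2 := differentiableAt_pi.1 hX
  unfold fpair
  rw [fderiv_fun_sum (fun j _ => (h1 j).fun_mul (h2 j))]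
  rw [ContinuousLinearMap.sum_apply]
  refine Finset.sum_congr rfl fun j _ => ?_
  rw [fderiv_fun_mul (h1 j) (h2 j)]
  simp

/-- coordinate formula -/
lemma dpair_coord {ω : Form m} {X Y : VF m} {x : Fin m → ℝ} (hω : DifferentiableAt ℝ ω x)
    (hX : DifferentiableAt ℝ X x) (hY : DifferentiableAt ℝ Y x) :
    dpair ω X Y x = ∑ i, ∑ j, (X x i * Y x j - Y x i * X x j) *
      fderiv ℝ (fun y => ω y j) x (Pi.single i 1) := by
  unfold dpair vapp vbrk
  simp only [fderiv_fpair hω hX, fderiv_fpair hω hY]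
  simp only [fpair, vapp, mul_sub, Finset.mul_sum, Finset.sum_sub_distrib]
  rw [Finset.sum_comm (f := fun i j => ω x i * (X x j * _)),
    Finset.sum_comm (f := fun i j => ω x i * (Y x j * _))]
  simp only [← Finset.sum_sub_distrib]
  refine Finset.sum_congr rfl fun i _ => Finset.sum_congr rfl fun j _ => ?_
  ring

lemma fpair_lieD {ω : Form m} {X Y : VF m} {x : Fin m → ℝ} (hω : DifferentiableAt ℝ ω x)
    (hX : DifferentiableAt ℝ X x) (hY : DifferentiableAt ℝ Y x) :
    fpair (lieD X ω) Y x = dpair ω X Y x := by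
  rw [dpair_coord hω hX hY]
  unfold fpair lieD
  simp only [dpair_coord hω hX (differentiableAt_const _)]
  have : ∀ k, (∑ i, ∑ j, (X x i * (Pi.single k 1 : Fin m → ℂ) j
      - (Pi.single k 1 : Fin m → ℂ) i * X x j) * fderiv ℝ (fun y => ω y j) x (Pi.single i 1)) * Y x k
      = ∑ i, (X x i * Y x k * fderiv ℝ (fun y => ω y k) x (Pi.single i 1))
        - ∑ j, (Y x k * X x j * fderiv ℝ (fun y => ω y j) x (Pi.single k 1)) := by
    intro k
    simp only [sub_mul, Finset.sum_sub_distrib]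
    congr 1
    · rw [Finset.sum_mul]
      refine Finset.sum_congr rfl fun i _ => ?_
      rw [Finset.sum_eq_single k]
      · simp; ring
      · intro b _ hb; simp [Pi.single_eq_of_ne hb]
      · simp
    · rw [Finset.sum_eq_single k]
      · simp [Finset.sum_mul]
        refine Finset.sum_congr rfl fun i _ => ?_
        ring
      · intro b _ hb; simp [Pi.single_eq_of_ne hb]
      · simp
  rw [Finset.sum_congr rfl fun k _ => this k]
  simp only [Finset.sum_sub_distrib, sub_mul]
  rw [Finset.sum_comm]

lemma vapp_congr (hΩ : IsOpen Ω) (X : VF m) {f g : (Fin m → ℝ) → ℂ} (h : ∀ x ∈ Ω, f x = g x) :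
    ∀ x ∈ Ω, vapp X f x = vapp X g x := by
  intro x hx
  have : f =ᶠ[𝓝 x] g := Filter.eventually_of_mem (hΩ.mem_nhds hx) h
  unfold vapp
  rw [this.fderiv_eq]

lemma vapp_zero_of (hΩ : IsOpen Ω) (X : VF m) {f : (Fin m → ℝ) → ℂ} (h : ∀ x ∈ Ω, f x = 0) :
    ∀ x ∈ Ω, vapp X f x = 0 := by
  intro x hx
  rw [vapp_congr hΩ X (g := fun _ => 0) h x hx]
  simp [vapp]

lemma vapp_add (X : VF m) {f g : (Fin m → ℝ) → ℂ} {x : Fin m → ℝ} (hf : DifferentiableAt ℝ f x)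
    (hg : DifferentiableAt ℝ g x) :
    vapp X (fun y => f y + g y) x = vapp X f x + vapp X g x := by
  simp [vapp, fderiv_fun_add hf hg, mul_add, Finset.sum_add_distrib]

lemma vapp_mul (X : VF m) {f g : (Fin m → ℝ) → ℂ} {x : Fin m → ℝ} (hf : DifferentiableAt ℝ f x)
    (hg : DifferentiableAt ℝ g x) :
    vapp X (fun y => f y * g y) x = vapp X f x * g x + f x * vapp X g x := by
  simp only [vapp, fderiv_fun_mul hf hg, Finset.sum_mul, Finset.mul_sum,
    ← Finset.sum_add_distrib]
  refine Finset.sum_congr rfl fun i _ => ?_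
  simp
  ring

/-- functions all of whose derivatives of order `< s` along the `Z A` vanish at `0` -/
def Iv {ι : Type} (Z : ι → VF m) : ℕ → ((Fin m → ℝ) → ℂ) → Prop
  | 0, _ => True
  | s + 1, f => f 0 = 0 ∧ ∀ A, Iv Z s (vapp (Z A) f)

variable {ι : Type} {Z : ι → VF m}

lemma Iv.congr (hΩ : IsOpen Ω) (h0 : (0 : Fin m → ℝ) ∈ Ω) (s : ℕ) :
    ∀ {f g : (Fin m → ℝ) → ℂ}, (∀ x ∈ Ω, f x = g x) → Iv Z s f → Iv Z s g := by
  induction s with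
  | zero => intros; trivial
  | succ s ih =>
    intro f g h hf
    exact ⟨(h 0 h0) ▸ hf.1, fun A => ih (vapp_congr hΩ _ h) (hf.2 A)⟩

lemma Iv.pred (s : ℕ) : ∀ {f : (Fin m → ℝ) → ℂ}, Iv Z (s + 1) f → Iv Z s f := by
  induction s with
  | zero => intros; trivial
  | succ s ih => intro f h; exact ⟨h.1, fun A => ih (h.2 A)⟩

lemma Iv.mono {s t : ℕ} (hst : s ≤ t) {f : (Fin m → ℝ) → ℂ} (h : Iv Z t f) : Iv Z s f := by
  induction t, hst using Nat.le_induction with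
  | base => exact h
  | succ t _ ih => exact ih h.pred

lemma Iv.add (hΩ : IsOpen Ω) (h0 : (0 : Fin m → ℝ) ∈ Ω) (hZ : ∀ A, Sm Ω (Z A)) (s : ℕ) :
    ∀ {f g : (Fin m → ℝ) → ℂ}, Sm Ω f → Sm Ω g → Iv Z s f → Iv Z s g →
      Iv Z s (fun x => f x + g x) := by
  induction s with
  | zero => intros; trivial
  | succ s ih =>
    intro f g hf hg h1 h2
    refine ⟨by simp [h1.1, h2.1], fun A => ?_⟩
    refine Iv.congr hΩ h0 s (fun x hx => (vapp_add (Z A) (hf.dat hΩ hx) (hg.dat hΩ hx)).symm) ?_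
    exact ih (sm_vapp hΩ (hZ A) hf) (sm_vapp hΩ (hZ A) hg) (h1.2 A) (h2.2 A)

lemma Iv.mul (hΩ : IsOpen Ω) (h0 : (0 : Fin m → ℝ) ∈ Ω) (hZ : ∀ A, Sm Ω (Z A)) (s : ℕ) :
    ∀ {f g : (Fin m → ℝ) → ℂ}, Sm Ω f → Sm Ω g → Iv Z s f → Iv Z s (fun x => f x * g x) := by
  induction s with
  | zero => intros; trivial
  | succ s ih =>
    intro f g hf hg h1
    refine ⟨by simp [h1.1], fun A => ?_⟩
    refine Iv.congr hΩ h0 s (fun x hx => (vapp_mul (Z A) (hf.dat hΩ hx) (hg.dat hΩ hx)).symm) ?_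
    have a1 := sm_vapp hΩ (hZ A) hf
    have a2 := sm_vapp hΩ (hZ A) hg
    exact Iv.add hΩ h0 hZ s (a1.mul hg) (hf.mul a2) (ih a1 hg (h1.2 A)) (ih hf a2 h1.pred)

lemma Iv.zero (s : ℕ) : Iv Z s (fun _ => (0 : ℂ)) := by
  induction s with
  | zero => trivial
  | succ s ih =>
    refine ⟨rfl, fun A => ?_⟩
    have : vapp (Z A) (fun _ => (0 : ℂ)) = fun _ => 0 := by funext x; simp [vapp]
    rw [this]; exact ih

lemma Iv.sum (hΩ : IsOpen Ω) (h0 : (0 : Fin m → ℝ) ∈ Ω) (hZ : ∀ A, Sm Ω (Z A)) (s : ℕ)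
    {κ : Type} (S : Finset κ) {f : κ → (Fin m → ℝ) → ℂ} (hf : ∀ k, Sm Ω (f k))
    (h : ∀ k, Iv Z s (f k)) : Iv Z s (fun x => ∑ k ∈ S, f k x) := by
  classical
  induction S using Finset.induction_on with
  | empty => simpa using Iv.zero s
  | insert a S ha ih =>
    simp only [Finset.sum_insert ha]
    exact Iv.add hΩ h0 hZ s (hf a) (ContDiffOn.sum fun k _ => hf k) (h a) ih

end helpers

section frame

variable {n : ℕ} {Ω : Set (Fin (2 * n + 1) → ℝ)}
    {T : VF (2 * n + 1)} {L : Fin n → VF (2 * n + 1)} {θ : Form (2 * n + 1)}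
    {θup θbar : Fin n → Form (2 * n + 1)}

abbrev iw (L : Fin n → VF (2 * n + 1)) (θ : Form (2 * n + 1)) (As : List (Fin n)) :
    Form (2 * n + 1) := iterLieD (As.map fun A => vconj (L A)) θ

lemma iw_append (As : List (Fin n)) (A : Fin n) :
    iw L θ (As ++ [A]) = lieD (vconj (L A)) (iw L θ As) := by
  simp [iw, iterLieD]

lemma brk_append (As : List (Fin n)) (A D : Fin n) :
    brkIter L (As ++ [A]) D = vbrk (vconj (L A)) (brkIter L As D) := by
  simp [brkIter]

lemma sm_iw (hfr : CRFrame n Ω T L θ θup θbar) (As : List (Fin n)) : Sm Ω (iw L θ As) := by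
  induction As using List.reverseRecOn with
  | nil => exact hfr.smoothθ
  | append_singleton As A ih =>
    rw [iw_append]; exact sm_lieD hfr.open_Ω (sm_vconj (hfr.smoothL A)) ih

lemma sm_brk (hfr : CRFrame n Ω T L θ θup θbar) (As : List (Fin n)) (D : Fin n) :
    Sm Ω (brkIter L As D) := by
  induction As using List.reverseRecOn with
  | nil => exact hfr.smoothL D
  | append_singleton As A ih =>
    rw [brk_append]; exact sm_vbrk hfr.open_Ω (sm_vconj (hfr.smoothL A)) ih

lemma star (hfr : CRFrame n Ω T L θ θup θbar) {ω : Form (2 * n + 1)} (hω : Sm Ω ω)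
    (hk : ∀ B, ∀ x ∈ Ω, fpair ω (vconj (L B)) x = 0) {X : VF (2 * n + 1)} (hX : Sm Ω X)
    (A : Fin n) : ∀ x ∈ Ω, fpair (lieD (vconj (L A)) ω) X x =
      vapp (vconj (L A)) (fpair ω X) x - fpair ω (vbrk (vconj (L A)) X) x := by
  intro x hx
  have hΩ := hfr.open_Ω
  rw [fpair_lieD (hω.dat hΩ hx) ((sm_vconj (hfr.smoothL A)).dat hΩ hx) (hX.dat hΩ hx), dpair,
    vapp_zero_of hΩ X (hk A) x hx]
  ring

lemma iw_kill (hfr : CRFrame n Ω T L θ θup θbar) (As : List (Fin n)) :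
    ∀ B, ∀ x ∈ Ω, fpair (iw L θ As) (vconj (L B)) x = 0 := by
  induction As using List.reverseRecOn with
  | nil => exact hfr.dual_θ_Lb
  | append_singleton As A ih =>
    intro B x hx
    rw [iw_append, star hfr (sm_iw hfr As) ih (sm_vconj (hfr.smoothL B)) A x hx,
      vapp_zero_of hfr.open_Ω _ (ih B) x hx, zero_sub, neg_eq_zero]
    have h := hfr.integrable A B x hx
    have : ∀ v ∈ Submodule.span ℂ (Set.range fun C => vconj (L C) x),
        ∑ i, iw L θ As x i * v i = 0 := by
      intro v hv
      induction hv using Submodule.span_induction with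
      | mem v hv => obtain ⟨C, rfl⟩ := hv; exact ih C x hx
      | zero => simp
      | add v w _ _ h1 h2 => simp [mul_add, Finset.sum_add_distrib, h1, h2]
      | smul c v _ h1 =>
        simp only [Pi.smul_apply, smul_eq_mul, mul_left_comm _ c, ← Finset.mul_sum, h1, mul_zero]
    exact this _ h

lemma decomp (hfr : CRFrame n Ω T L θ θup θbar) {ω : Form (2 * n + 1)}
    (hk : ∀ B, ∀ x ∈ Ω, fpair ω (vconj (L B)) x = 0) (X : VF (2 * n + 1)) :
    ∀ x ∈ Ω, fpair ω X x = fpair θ X x * fpair ω T x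
      + ∑ C, fpair (θup C) X x * fpair ω (L C) x := by
  intro x hx
  have : ∀ v : Fin (2 * n + 1) → ℂ, v ∈ Submodule.span ℂ
    (Set.range (Sum.elim (fun _ : Fin 1 => T x)
      (Sum.elim (fun A => L A x) (fun A => vconj (L A) x)))) →
      ∑ i, ω x i * v i = (∑ i, θ x i * v i) * fpair ω T x
        + ∑ C, (∑ i, θup C x i * v i) * fpair ω (L C) x := by
    intro v hv
    induction hv using Submodule.span_induction with
    | mem v hv =>
      obtain ⟨C, rfl⟩ := hv
      rcases C with C | C | C
      · have h1 := hfr.dual_θ_T x hx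
        have h2 := fun A => hfr.dual_θup_T A x hx
        change fpair ω T x = fpair θ T x * fpair ω T x
          + ∑ C, fpair (θup C) T x * fpair ω (L C) x
        simp [h1, h2]
      · have h1 := hfr.dual_θ_L C x hx
        have h2 := fun A => hfr.dual_θup_L A C x hx
        change fpair ω (L C) x = fpair θ (L C) x * fpair ω T x
          + ∑ D, fpair (θup D) (L C) x * fpair ω (L D) x
        simp [h1, h2]
      · have h1 := hfr.dual_θ_Lb C x hx
        have h2 := fun A => hfr.dual_θup_Lb A C x hx
        change fpair ω (vconj (L C)) x = fpair θ (vconj (L C)) x * fpair ω T x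
          + ∑ D, fpair (θup D) (vconj (L C)) x * fpair ω (L D) x
        simp [h1, h2, hk C x hx]
    | zero => simp
    | add v w _ _ h1 h2 =>
      simp only [Pi.add_apply, mul_add, Finset.sum_add_distrib, h1, h2, add_mul]
      ring
    | smul c v _ h1 =>
      simp only [Pi.smul_apply, smul_eq_mul, mul_left_comm _ c, ← Finset.mul_sum, h1, mul_assoc,
        mul_add]
  exact this (X x) (by rw [hfr.spans x hx]; trivial)

lemma b_one (hfr : CRFrame n Ω T L θ θup θbar) (A D : Fin n) :
    ∀ x ∈ Ω, fpair θ (vbrk (vconj (L A)) (L D)) x = - hD L θ [A] D x := by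
  intro x hx
  have h := star hfr hfr.smoothθ hfr.dual_θ_Lb (hfr.smoothL D) A x hx
  rw [vapp_zero_of hfr.open_Ω _ (hfr.dual_θ_L D) x hx] at h
  change _ = - fpair (lieD (vconj (L A)) θ) (L D) x
  rw [h]; ring

lemma h_rec (hfr : CRFrame n Ω T L θ θup θbar) (As : List (Fin n)) (A D : Fin n) :
    ∀ x ∈ Ω, hD L θ (As ++ [A]) D x = vapp (vconj (L A)) (hD L θ As D) x
      + hD L θ [A] D x * hT L T θ As x
      - ∑ C, hD L θ As C x * fpair (θup C) (vbrk (vconj (L A)) (L D)) x := by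
  intro x hx
  have h := star hfr (sm_iw hfr As) (iw_kill hfr As) (hfr.smoothL D) A x hx
  rw [decomp hfr (iw_kill hfr As) (vbrk (vconj (L A)) (L D)) x hx, b_one hfr A D x hx,
    ← iw_append] at h
  change fpair (iw L θ (As ++ [A])) (L D) x = _
  rw [h]
  simp only [hD, hT, iw, mul_comm]
  ring

lemma b_rec (hfr : CRFrame n Ω T L θ θup θbar) (As : List (Fin n)) (A D : Fin n) :
    ∀ x ∈ Ω, fpair θ (brkIter L (As ++ [A]) D) x =
      vapp (vconj (L A)) (fpair θ (brkIter L As D)) x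
      - fpair θ (brkIter L As D) x * hT L T θ [A] x
      - ∑ C, hD L θ [A] C x * fpair (θup C) (brkIter L As D) x := by
  intro x hx
  have h := star hfr hfr.smoothθ hfr.dual_θ_Lb (sm_brk hfr As D) A x hx
  have h2 := decomp hfr (iw_kill hfr [A]) (brkIter L As D) x hx
  change fpair (lieD (vconj (L A)) θ) (brkIter L As D) x = _ at h2
  rw [h2] at h
  rw [brk_append]
  simp only [hD, hT, iw, mul_comm] at h ⊢
  linear_combination h

lemma sm_hD (hfr : CRFrame n Ω T L θ θup θbar) (As : List (Fin n)) (D : Fin n) :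
    Sm Ω (hD L θ As D) := sm_fpair (sm_iw hfr As) (hfr.smoothL D)

lemma sm_hT (hfr : CRFrame n Ω T L θ θup θbar) (As : List (Fin n)) :
    Sm Ω (hT L T θ As) := sm_fpair (sm_iw hfr As) hfr.smoothT

lemma h_Iv (hfr : CRFrame n Ω T L θ θup θbar) (N : ℕ)
    (hv : ∀ (As : List (Fin n)) (D : Fin n), 1 ≤ As.length → As.length < N → hD L θ As D 0 = 0)
    (s : ℕ) : ∀ (As : List (Fin n)) (D : Fin n), 1 ≤ As.length → As.length + s ≤ N →
      Iv (fun A => vconj (L A)) s (hD L θ As D) := by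
  have hΩ := hfr.open_Ω
  have h0 := hfr.mem0
  have hZ : ∀ A, Sm Ω (vconj (L A)) := fun A => sm_vconj (hfr.smoothL A)
  induction s with
  | zero => intros; trivial
  | succ s ih =>
    intro As D h1 hN
    refine ⟨hv As D h1 (by omega), fun A => ?_⟩
    have key : ∀ x ∈ Ω, (hD L θ (As ++ [A]) D x + hD L θ [A] D x * (-1 * hT L T θ As x))
      + ∑ C, hD L θ As C x * fpair (θup C) (vbrk (vconj (L A)) (L D)) x
      = vapp (vconj (L A)) (hD L θ As D) x := by
      intro x hx
      rw [h_rec hfr As A D x hx]; ring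
    refine Iv.congr hΩ h0 s key ?_
    have sT : Sm Ω (fun x => -1 * hT L T θ As x) := contDiffOn_const.mul (sm_hT hfr As)
    have sC : ∀ C, Sm Ω (fpair (θup C) (vbrk (vconj (L A)) (L D))) := fun C =>
      sm_fpair (hfr.smoothθup C) (sm_vbrk hΩ (hZ A) (hfr.smoothL D))
    have s1 := sm_hD hfr (As ++ [A]) D
    have s2 := (sm_hD hfr [A] D).mul sT
    have s3 := fun C => (sm_hD hfr As C).mul (sC C)
    refine Iv.add hΩ h0 hZ s (s1.add s2) (ContDiffOn.sum fun C _ => s3 C) ?_ ?_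
    · refine Iv.add hΩ h0 hZ s s1 s2 (ih _ _ (by simp) (by simp; omega)) ?_
      exact Iv.mul hΩ h0 hZ s (sm_hD hfr [A] D) sT (ih _ _ (by simp) (by simp; omega))
    · exact Iv.sum hΩ h0 hZ s _ s3 fun C => Iv.mul hΩ h0 hZ s (sm_hD hfr As C) (sC C)
        (ih _ _ h1 (by omega))

lemma b_Iv (hfr : CRFrame n Ω T L θ θup θbar) (N : ℕ)
    (hv : ∀ (As : List (Fin n)) (D : Fin n), 1 ≤ As.length → As.length < N → hD L θ As D 0 = 0)
    (As : List (Fin n)) (D : Fin n) : ∀ (s : ℕ), 1 ≤ As.length → As.length + s ≤ N + 1 →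
      Iv (fun A => vconj (L A)) s (fun x => fpair θ (brkIter L As D) x + hD L θ As D x) := by
  have hΩ := hfr.open_Ω
  have h0 := hfr.mem0
  have hZ : ∀ A, Sm Ω (vconj (L A)) := fun A => sm_vconj (hfr.smoothL A)
  induction As using List.reverseRecOn with
  | nil => intro s h; simp at h
  | append_singleton As A ih =>
    intro s h1 hN
    rcases Nat.eq_zero_or_pos As.length with h | h
    · rw [List.length_eq_zero_iff] at h
      subst h
      refine Iv.congr hΩ h0 s (f := fun _ => 0) (fun x hx => ?_) (Iv.zero s)
      have := b_one hfr A D x hx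
      change 0 = fpair θ (vbrk (vconj (L A)) (L D)) x + hD L θ [A] D x
      rw [this]; ring
    · simp only [List.length_append, List.length_singleton] at hN
      have I1 := (ih (s + 1) h (by omega))
      have sb := sm_fpair hfr.smoothθ (sm_brk hfr As D)
      have sh := sm_hD hfr As D
      have Ih : ∀ C, Iv (fun A => vconj (L A)) s (hD L θ As C) := fun C =>
        h_Iv hfr N hv s As C h (by omega)
      have Ih1 : ∀ C, Iv (fun A => vconj (L A)) s (hD L θ [A] C) := fun C =>
        h_Iv hfr N hv s [A] C (by simp) (by simp; omega)
      have sm1 : Sm Ω (fun _ : Fin (2 * n + 1) → ℝ => (-1 : ℂ)) := contDiffOn_const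
      have Ib : Iv (fun A => vconj (L A)) s (fpair θ (brkIter L As D)) := by
        refine Iv.congr hΩ h0 s (fun x hx => ?_) (Iv.add hΩ h0 hZ s (sb.add sh) (sh.mul sm1)
          I1.pred (Iv.mul hΩ h0 hZ s sh sm1 (Ih D)))
        simp
      have sTA : Sm Ω (fun x => -1 * hT L T θ [A] x) := contDiffOn_const.mul (sm_hT hfr [A])
      have sT := sm_hT hfr As
      have sC : ∀ C, Sm Ω (fun x => -1 * fpair (θup C) (brkIter L As D) x) := fun C =>
        contDiffOn_const.mul (sm_fpair (hfr.smoothθup C) (sm_brk hfr As D))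
      have sC' : ∀ C, Sm Ω (fun x => -1 * fpair (θup C) (vbrk (vconj (L A)) (L D)) x) := fun C =>
        contDiffOn_const.mul (sm_fpair (hfr.smoothθup C) (sm_vbrk hΩ (hZ A) (hfr.smoothL D)))
      have a1 := sm_vapp hΩ (hZ A) (sb.add sh)
      have a2 := sb.mul sTA
      have a3 := fun C => (sm_hD hfr [A] C).mul (sC C)
      have a4 := (sm_hD hfr [A] D).mul sT
      have a5 := fun C => (sm_hD hfr As C).mul (sC' C)
      have b3 : Sm Ω (fun x => ∑ C, hD L θ [A] C x * (-1 * fpair (θup C) (brkIter L As D) x)) :=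
        ContDiffOn.sum fun C _ => a3 C
      have b5 : Sm Ω (fun x => ∑ C, hD L θ As C x *
        (-1 * fpair (θup C) (vbrk (vconj (L A)) (L D)) x)) := ContDiffOn.sum fun C _ => a5 C
      have j2 := Iv.mul hΩ h0 hZ s sb sTA Ib
      have j3 := Iv.sum hΩ h0 hZ s Finset.univ a3
        fun C => Iv.mul hΩ h0 hZ s (sm_hD hfr [A] C) (sC C) (Ih1 C)
      have j4 := Iv.mul hΩ h0 hZ s (sm_hD hfr [A] D) sT (Ih1 D)
      have j5 := Iv.sum hΩ h0 hZ s Finset.univ a5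
        fun C => Iv.mul hΩ h0 hZ s (sm_hD hfr As C) (sC' C) (Ih C)
      have J := Iv.add hΩ h0 hZ s (((a1.add a2).add b3).add a4) b5
        (Iv.add hΩ h0 hZ s ((a1.add a2).add b3) a4
          (Iv.add hΩ h0 hZ s (a1.add a2) b3 (Iv.add hΩ h0 hZ s a1 a2 (I1.2 A) j2) j3) j4) j5
      refine Iv.congr hΩ h0 s (fun x hx => ?_) J
      simp only [b_rec hfr As A D x hx, h_rec hfr As A D x hx, Pi.add_apply]
      have := vapp_add (vconj (L A)) (sb.dat hΩ hx) (sh.dat hΩ hx)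
      have e : (fpair θ (brkIter L As D) + hD L θ As D)
        = fun y => fpair θ (brkIter L As D) y + hD L θ As D y := rfl
      simp only [e, this]
      simp only [neg_mul, one_mul, mul_neg, Finset.sum_neg_distrib]
      ring

end frame

/-- With `ℓ₀` the smallest integer `ℓ ≥ 1` such that `h_{Ā₁…Ā_ℓ D}(0) ≠ 0`
for some indices, and `ℓ₁` the smallest integer `ℓ ≥ 1` such that
`⟨θ, [L_Ā_ℓ, […, [L_Ā₁, L_D]…]]⟩(0) ≠ 0` for some indices (both `⊤` if none exists):
(i) for `1 ≤ r ≤ ℓ₀`, `⟨θ, [L_Ā_r, …, [L_Ā₁, L_D]…]⟩(0) = −h_{Ā₁…Ā_r D}(0)`;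
(ii) if either of `ℓ₀, ℓ₁` is finite, then `ℓ₀ = ℓ₁`. -/
theorem statement7 (n : ℕ) (hn : 1 ≤ n) (Ω : Set (Fin (2 * n + 1) → ℝ))
    (T : VF (2 * n + 1)) (L : Fin n → VF (2 * n + 1)) (θ : Form (2 * n + 1))
    (θup θbar : Fin n → Form (2 * n + 1))
    (hfr : CRFrame n Ω T L θ θup θbar)
    (ℓ₀ ℓ₁ : ℕ∞)
    (h₀van : ∀ (As : List (Fin n)) (D : Fin n), 1 ≤ As.length →
      (As.length : ℕ∞) < ℓ₀ → hD L θ As D 0 = 0)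
    (h₀ex : ∀ ℓ : ℕ, ℓ₀ = (ℓ : ℕ∞) →
      ∃ (As : List (Fin n)) (D : Fin n), As.length = ℓ ∧ hD L θ As D 0 ≠ 0)
    (h₀pos : 1 ≤ ℓ₀)
    (h₁van : ∀ (As : List (Fin n)) (D : Fin n), 1 ≤ As.length →
      (As.length : ℕ∞) < ℓ₁ → fpair θ (brkIter L As D) 0 = 0)
    (h₁ex : ∀ ℓ : ℕ, ℓ₁ = (ℓ : ℕ∞) →
      ∃ (As : List (Fin n)) (D : Fin n), As.length = ℓ ∧ fpair θ (brkIter L As D) 0 ≠ 0)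
    (h₁pos : 1 ≤ ℓ₁) :
    (∀ (As : List (Fin n)) (D : Fin n), 1 ≤ As.length → (As.length : ℕ∞) ≤ ℓ₀ →
      fpair θ (brkIter L As D) 0 = - hD L θ As D 0) ∧
    ((ℓ₀ ≠ ⊤ ∨ ℓ₁ ≠ ⊤) → ℓ₀ = ℓ₁) := by
  have hi : ∀ (As : List (Fin n)) (D : Fin n), 1 ≤ As.length → (As.length : ℕ∞) ≤ ℓ₀ →
      fpair θ (brkIter L As D) 0 = - hD L θ As D 0 := by
    intro As D h1 h2
    have := b_Iv hfr As.length (fun Bs E hB hlt => h₀van Bs E hB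
      (lt_of_lt_of_le (by exact_mod_cast hlt) h2)) As D 1 h1 le_rfl
    exact eq_neg_of_add_eq_zero_left this.1
  refine ⟨hi, fun _ => ?_⟩
  rcases lt_trichotomy ℓ₀ ℓ₁ with h | h | h
  · exfalso
    obtain ⟨ℓ, hℓ⟩ := ENat.ne_top_iff_exists.1 (ne_top_of_lt h)
    obtain ⟨As, D, hl, hne⟩ := h₀ex ℓ hℓ.symm
    have e : (As.length : ℕ∞) = ℓ₀ := by rw [hl, hℓ]
    have hp : 1 ≤ As.length := by
      have : (1 : ℕ∞) ≤ As.length := e ▸ h₀pos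
      exact_mod_cast this
    have h3 := hi As D hp e.le
    rw [h₁van As D hp (e ▸ h)] at h3
    exact hne (neg_eq_zero.1 h3.symm)
  · exact h
  · exfalso
    obtain ⟨ℓ, hℓ⟩ := ENat.ne_top_iff_exists.1 (ne_top_of_lt h)
    obtain ⟨As, D, hl, hne⟩ := h₁ex ℓ hℓ.symm
    have e : (As.length : ℕ∞) = ℓ₁ := by rw [hl, hℓ]
    have hp : 1 ≤ As.length := by
      have : (1 : ℕ∞) ≤ As.length := e ▸ h₁pos
      exact_mod_cast this
    have h3 := hi As D hp (e ▸ h.le)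
    rw [h₀van As D hp (e ▸ h), neg_zero] at h3
    exact hne h3
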